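/- The group G = ⟨x, y | x² = y³⟩ admits no bi-invariant total order, i.e., there is no total order on G invariant under both left and right multiplication. (This group is isomorphic to the braid group B₃.) -/

import Mathlib

/-- A group containing elements `x, y` with `x² = y³` and `xy ≠ yx`
(such as the braid group `B₃ = ⟨x, y | x² = y³⟩`) admits no bi-invariant
total order. -/
theorem no_biorder_of_rel {G : Type*} [Group G] (x y : G)
    (hrel : x ^ 2 = y ^ 3) (hne : x * y ≠ y * x) :
    ¬ ∃ lt : G → G → Prop,
      (∀ a, ¬ lt a a) ∧ (∀ a b c, lt a b → lt b c → lt a c) ∧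
      (∀ a b, lt a b ∨ a = b ∨ lt b a) ∧
      (∀ a b g, lt a b → lt (g * a) (g * b)) ∧
      (∀ a b g, lt a b → lt (a * g) (b * g)) := by
  rintro ⟨lt, irrefl, trans, total, left, right⟩
  have sq_lt : ∀ a b, lt a b → lt (a ^ 2) (b ^ 2) := fun a b h => by
    rw [pow_two, pow_two]
    exact trans _ _ _ (left a b a h) (right a b b h)
  have sq_conj : (y * x * y⁻¹) ^ 2 = x ^ 2 := by
    rw [conj_pow, hrel, mul_inv_eq_iff_eq_mul]
    exact (Commute.self_pow y 3).eq
  rcases total (y * x * y⁻¹) x with h | h | h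
  · exact irrefl _ (sq_conj ▸ sq_lt _ _ h)
  · exact hne (mul_inv_eq_iff_eq_mul.mp h).symm
  · exact irrefl _ (sq_conj ▸ sq_lt _ _ h)
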